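/- For every real orthogonal matrix A (i.e., a d × d real matrix with Aᵀ A = I), the determinant of I − A is nonnegative: det(I − A) ≥ 0. -/

import Mathlib

open Matrix

/-- For a real orthogonal matrix `A` and `0 ≤ t < 1`, the matrix `1 - t • A` is nonsingular. -/
theorem det_one_sub_smul_orthogonal_ne_zero {n : Type*} [Fintype n] [DecidableEq n]
    (A : Matrix n n ℝ) (hA : Aᵀ * A = 1) {t : ℝ} (ht0 : 0 ≤ t) (ht1 : t < 1) :
    (1 - t • A).det ≠ 0 := by
  intro h
  obtain ⟨v, hv, hAv⟩ := Matrix.exists_mulVec_eq_zero_iff.mpr h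
  have hfix : v = t • (A *ᵥ v) := by
    rwa [sub_mulVec, one_mulVec, smul_mulVec, sub_eq_zero] at hAv
  have hnorm : (A *ᵥ v) ⬝ᵥ (A *ᵥ v) = v ⬝ᵥ v := by
    rw [dotProduct_mulVec, vecMul_mulVec, ← dotProduct_mulVec, hA, one_mulVec]
  have hscale : v ⬝ᵥ v = t * (t * (v ⬝ᵥ v)) := by
    conv_lhs => rw [hfix]
    rw [smul_dotProduct, dotProduct_smul, hnorm, smul_eq_mul, smul_eq_mul]
  have hpos : 0 < v ⬝ᵥ v := by
    refine lt_of_le_of_ne (Finset.sum_nonneg fun i _ => mul_self_nonneg (v i)) ?_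
    exact fun h0 => hv (dotProduct_self_eq_zero.mp h0.symm)
  nlinarith [mul_pos hpos (sub_pos.mpr ht1), mul_nonneg ht0 (mul_pos hpos (sub_pos.mpr ht1)).le]

/-- For every real orthogonal matrix `A` (i.e. `Aᵀ A = 1`), `det (1 - A) ≥ 0`. -/
theorem det_one_sub_orthogonal_nonneg {d : ℕ} (A : Matrix (Fin d) (Fin d) ℝ)
    (hA : Aᵀ * A = 1) : 0 ≤ (1 - A).det := by
  by_contra! hneg
  have hcont : Continuous fun t : ℝ => (1 - t • A).det := by fun_prop
  obtain ⟨t, ⟨ht0, ht1⟩, ht⟩ := intermediate_value_Icc' zero_le_one hcont.continuousOn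
    (show (0 : ℝ) ∈ Set.Icc _ _ by simp [hneg.le])
  have ht' : (1 - t • A).det = 0 := ht
  rcases ht1.lt_or_eq with hlt | rfl
  · exact det_one_sub_smul_orthogonal_ne_zero A hA ht0 hlt ht'
  · rw [one_smul] at ht'
    exact hneg.ne ht'
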